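/- If M is a 5×5 matrix over a 3-letter alphabet that contains every 2×2 matrix over that alphabet as a submatrix, then every row of M contains every letter of the alphabet. -/

import Mathlib

/-- An `O(n,k,a)` omnimosaic (stated for possibly rectangular `m × n` arrays):
a matrix over the alphabet `Fin a` containing every `k × k` matrix over that
alphabet as a submatrix. -/
def IsOmnimosaic (a k : ℕ) {m n : ℕ} (M : Fin m → Fin n → Fin a) : Prop :=
  ∀ T : Fin k → Fin k → Fin a, ∃ ρ : Fin k → Fin m, ∃ σ : Fin k → Fin n,
    StrictMono ρ ∧ StrictMono σ ∧ ∀ i j, T i j = M (ρ i) (σ j)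

namespace Omni

/-- Packed table of the numbers of pairs `i < j` with `i ∈ U`, `j ∈ V` (sets as bit masks). -/
def xt : ℕ := 695986211446832157424602191512455760302248972641891729314775295703317080555879339384383092089762732509894366586682078280125114019920855701982810149511561336627555723937829267359902486337917420831813911875752555069673547665907917711267835471069524756417604058604122538830528545625259251073182944697681083324499508171082331252922723136778214199302411932815488101923790138592979494383431360917936349876099192257312143178384209457459979847593368936156028120057294239559868758676346726343412187744052862288408645696575402759181357450521393840176009902194150222924313289571758007205897482021983673812532636231200739387040934139005725780677494829970754761028670519341429761464550733303715194903788616311767854075573895148538189158867984533740401821019162462170953594735253143673273047228468610588358136633531101644463403411729091547316642748140824991232390228987183584136315073870566002115580762100940734381934909248480375913559606448622506364330257866745193412950402694835304027388466763322576796052996258242539420302623300120908619783273441919955872590614684498429295693787474496366886366799725228589566525446506274783826490145152957332300181653550190839821875245044186794387399399714604527533262412553071709747131625059282922038372597760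

def X (U V : ℕ) : ℕ :=
  Nat.mod (Nat.shiftRight xt (Nat.mul 4 (Nat.add (Nat.mul 32 U) V))) 16

/-- Packing of a vector into base 256. -/
def encF : ℕ → (ℕ → ℕ) → ℕ
  | 0, _ => 0
  | n + 1, f => Nat.add (f 0) (Nat.mul 256 (encF n (fun k => f (k + 1))))

def good (mask x : ℕ) : Bool := Nat.beq (Nat.land x mask) mask

def allR {α : Type} (L : List α) (f : α → Bool) : Bool :=
  List.rec true (fun a _ ih => and (f a) ih) L

theorem allR_mem {α : Type} (L : List α) (f : α → Bool) (h : allR L f = true) :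
    ∀ a ∈ L, f a = true := by
  induction L with
  | nil => simp
  | cons a l ih =>
    have h' : (f a && allR l f) = true := h
    simp only [Bool.and_eq_true] at h'
    intro c hc
    rcases List.mem_cons.1 hc with rfl | hc
    · exact h'.1
    · exact ih h'.2 c hc

def step {α : Type} (mask s : ℕ) (L : List (α × ℕ)) (w acc : ℕ) (k : α → ℕ → Bool) : Bool :=
  allR L fun p =>
    or (not (good mask (Nat.add (Nat.add acc (Nat.mul p.2 w)) s)))
      (k p.1 (Nat.add acc (Nat.mul p.2 w)))

theorem step_sound {α : Type} {mask s : ℕ} {L : List (α × ℕ)} {w acc : ℕ} {k : α → ℕ → Bool}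
    (h : step mask s L w acc k = true) {a : α} {x : ℕ} (hm : (a, x) ∈ L)
    (hg : good mask (acc + x * w + s) = true) : k a (acc + x * w) = true := by
  have := allR_mem _ _ h _ hm
  change (!(good mask (acc + x * w + s)) || k a (acc + x * w)) = true at this
  rw [hg] at this
  simpa using this

def engine {α : Type} (mask b e : ℕ) (L0 L1 L2 L3 L4 : List (α × ℕ)) (c1 c2 c3 c4 : ℕ)
    (leaf : α → α → α → α → α → Bool) : Bool :=
  step mask (e + c1 * (3 + b) + c2 * (2 + 2 * b) + c3 * (1 + 3 * b) + c4 * (4 * b)) L0 4 0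
    fun a0 x0 =>
  step mask (e + c2 * (2 + 2 * b) + c3 * (1 + 3 * b) + c4 * (4 * b)) L1 (3 + b) x0 fun a1 x1 =>
  step mask (e + c3 * (1 + 3 * b) + c4 * (4 * b)) L2 (2 + 2 * b) x1 fun a2 x2 =>
  step mask (e + c4 * (4 * b)) L3 (1 + 3 * b) x2 fun a3 x3 =>
  step mask e L4 (4 * b) x3 fun a4 _ => leaf a0 a1 a2 a3 a4

theorem encF_lin (m c0 c1 c2 c3 c4 : ℕ) : ∀ (d v0 v1 v2 v3 v4 : ℕ → ℕ),
    encF m (fun k => d k + (c0 * v0 k + c1 * v1 k + c2 * v2 k + c3 * v3 k + c4 * v4 k)) =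
      encF m d + (c0 * encF m v0 + c1 * encF m v1 + c2 * encF m v2 + c3 * encF m v3
        + c4 * encF m v4) := by
  induction m with
  | zero => intros; simp [encF]
  | succ m ih =>
    intro d v0 v1 v2 v3 v4
    simp only [encF, Nat.add_eq, Nat.mul_eq]
    rw [ih (fun k => d (k + 1)) (fun k => v0 (k + 1)) (fun k => v1 (k + 1))
      (fun k => v2 (k + 1)) (fun k => v3 (k + 1)) (fun k => v4 (k + 1))]
    ring

theorem encF_append (n : ℕ) (m : ℕ) : ∀ (f g : ℕ → ℕ),
    encF m f + 256 ^ m * encF n g = encF (m + n) (fun k => if k < m then f k else g (k - m)) := by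
  induction m with
  | zero => intro f g; simp [encF]
  | succ m ih =>
    intro f g
    rw [show m + 1 + n = (m + n) + 1 by ring]
    simp only [encF, Nat.add_eq, Nat.mul_eq]
    have := ih (fun k => f (k + 1)) g
    simp only [Nat.add_lt_add_iff_right, Nat.add_sub_add_right]
    rw [← this]
    simp
    ring

theorem land_step (a x y : ℕ) (h1 : 128 ≤ a) (h2 : a < 256) :
    (a + 256 * x) &&& (128 + 256 * y) = 128 + 256 * (x &&& y) := by
  have e1 : ((a + 256 * x) &&& (128 + 256 * y)) % 2 ^ 8 = 128 := by
    rw [Nat.and_mod_two_pow]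
    have : (a + 256 * x) % 2 ^ 8 = a := by omega
    rw [this]
    have : (128 + 256 * y) % 2 ^ 8 = 128 := by omega
    rw [this]
    interval_cases a <;> rfl
  have e2 : ((a + 256 * x) &&& (128 + 256 * y)) / 2 ^ 8 = x &&& y := by
    rw [Nat.and_div_two_pow]
    congr 1 <;> omega
  omega

theorem encF_good (n : ℕ) : ∀ (f : ℕ → ℕ), (∀ k < n, 128 ≤ f k ∧ f k < 256) →
    encF n f &&& encF n (fun _ => 128) = encF n (fun _ => 128) := by
  induction n with
  | zero => intros; simp [encF]
  | succ n ih =>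
    intro f hf
    simp only [encF, Nat.add_eq, Nat.mul_eq]
    rw [land_step _ _ _ (hf 0 (by omega)).1 (hf 0 (by omega)).2,
      ih _ (fun k hk => hf (k + 1) (by omega))]

theorem good_key (m : ℕ) (d need v0 v1 v2 v3 v4 u0 u1 u2 u3 u4 : ℕ → ℕ)
    (hd : ∀ k < m, d k + need k = 128)
    (ht : ∀ k < m, need k ≤ 4 * v0 k + 3 * v1 k + 2 * v2 k + v3 k)
    (hb : ∀ k < m, need k ≤ v1 k + 2 * v2 k + 3 * v3 k + 4 * v4 k)
    (h0 : ∀ k < m, v0 k ≤ u0 k ∧ u0 k ≤ 10) (h1 : ∀ k < m, v1 k ≤ u1 k ∧ u1 k ≤ 10)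
    (h2 : ∀ k < m, v2 k ≤ u2 k ∧ u2 k ≤ 10) (h3 : ∀ k < m, v3 k ≤ u3 k ∧ u3 k ≤ 10)
    (h4 : ∀ k < m, v4 k ≤ u4 k ∧ u4 k ≤ 10) (x : ℕ)
    (hx : x = encF m d * (1 + 256 ^ m) + encF m u0 * 4 + encF m u1 * (3 + 256 ^ m)
      + encF m u2 * (2 + 2 * 256 ^ m) + encF m u3 * (1 + 3 * 256 ^ m)
      + encF m u4 * (4 * 256 ^ m)) :
    good (encF (m + m) (fun _ => 128)) x = true := by
  have e : x = encF m (fun k => d k + (4 * u0 k + 3 * u1 k + 2 * u2 k + 1 * u3 k + 0 * u4 k))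
      + 256 ^ m * encF m
        (fun k => d k + (0 * u0 k + 1 * u1 k + 2 * u2 k + 3 * u3 k + 4 * u4 k)) := by
    rw [encF_lin, encF_lin, hx]; ring
  rw [encF_append] at e
  have : x &&& encF (m + m) (fun _ => 128) = encF (m + m) (fun _ => 128) := by
    rw [e]
    apply encF_good
    intro k hk
    by_cases hkm : k < m
    · simp only [hkm, if_true]
      have := hd k hkm; have := ht k hkm; have := h0 k hkm; have := h1 k hkm
      have := h2 k hkm; have := h3 k hkm; have := h4 k hkm
      omega
    · simp only [hkm, if_false]
      have hkm : k - m < m := by omega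
      generalize k - m = k at *
      have := hd k hkm; have := hb k hkm; have := h0 k hkm; have := h1 k hkm
      have := h2 k hkm; have := h3 k hkm; have := h4 k hkm
      omega
  unfold good
  exact Nat.beq_eq.mpr this

theorem engine_sound {α : Type} (m : ℕ) (d need v0 v1 v2 v3 v4 u1 u2 u3 u4 : ℕ → ℕ)
    (hd : ∀ k < m, d k + need k = 128)
    (ht : ∀ k < m, need k ≤ 4 * v0 k + 3 * v1 k + 2 * v2 k + v3 k)
    (hb : ∀ k < m, need k ≤ v1 k + 2 * v2 k + 3 * v3 k + 4 * v4 k)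
    (h0 : ∀ k < m, v0 k ≤ 10) (h1 : ∀ k < m, v1 k ≤ u1 k ∧ u1 k ≤ 10)
    (h2 : ∀ k < m, v2 k ≤ u2 k ∧ u2 k ≤ 10) (h3 : ∀ k < m, v3 k ≤ u3 k ∧ u3 k ≤ 10)
    (h4 : ∀ k < m, v4 k ≤ u4 k ∧ u4 k ≤ 10)
    (mask b e : ℕ) (L0 L1 L2 L3 L4 : List (α × ℕ)) (c1 c2 c3 c4 : ℕ)
    (leaf : α → α → α → α → α → Bool) (a0 a1 a2 a3 a4 : α)
    (hmask : mask = encF (m + m) (fun _ => 128)) (hbb : b = 256 ^ m)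
    (he : e = encF m d * (1 + 256 ^ m))
    (hc1 : c1 = encF m u1) (hc2 : c2 = encF m u2) (hc3 : c3 = encF m u3) (hc4 : c4 = encF m u4)
    (m0 : (a0, encF m v0) ∈ L0) (m1 : (a1, encF m v1) ∈ L1) (m2 : (a2, encF m v2) ∈ L2)
    (m3 : (a3, encF m v3) ∈ L3) (m4 : (a4, encF m v4) ∈ L4)
    (h : engine mask b e L0 L1 L2 L3 L4 c1 c2 c3 c4 leaf = true) :
    leaf a0 a1 a2 a3 a4 = true := by
  subst hmask hbb he hc1 hc2 hc3 hc4
  have h0' : ∀ k < m, v0 k ≤ v0 k ∧ v0 k ≤ 10 := fun k hk => ⟨le_rfl, h0 k hk⟩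
  have h1' : ∀ k < m, v1 k ≤ v1 k ∧ v1 k ≤ 10 :=
    fun k hk => ⟨le_rfl, (h1 k hk).1.trans (h1 k hk).2⟩
  have h2' : ∀ k < m, v2 k ≤ v2 k ∧ v2 k ≤ 10 :=
    fun k hk => ⟨le_rfl, (h2 k hk).1.trans (h2 k hk).2⟩
  have h3' : ∀ k < m, v3 k ≤ v3 k ∧ v3 k ≤ 10 :=
    fun k hk => ⟨le_rfl, (h3 k hk).1.trans (h3 k hk).2⟩
  have h4' : ∀ k < m, v4 k ≤ v4 k ∧ v4 k ≤ 10 :=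
    fun k hk => ⟨le_rfl, (h4 k hk).1.trans (h4 k hk).2⟩
  unfold engine at h
  have s0 := step_sound h m0
    (good_key m d need v0 v1 v2 v3 v4 _ _ _ _ _ hd ht hb h0' h1 h2 h3 h4 _ (by ring))
  have s1 := step_sound s0 m1
    (good_key m d need v0 v1 v2 v3 v4 _ _ _ _ _ hd ht hb h0' h1' h2 h3 h4 _ (by ring))
  have s2 := step_sound s1 m2
    (good_key m d need v0 v1 v2 v3 v4 _ _ _ _ _ hd ht hb h0' h1' h2' h3 h4 _ (by ring))
  have s3 := step_sound s2 m3
    (good_key m d need v0 v1 v2 v3 v4 _ _ _ _ _ hd ht hb h0' h1' h2' h3' h4 _ (by ring))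
  exact step_sound s3 m4
    (good_key m d need v0 v1 v2 v3 v4 _ _ _ _ _ hd ht hb h0' h1' h2' h3' h4' _ (by ring))

/-! ### Second stage: all three letters -/

def sel (R A : ℕ) : ℕ → ℕ
  | 0 => R
  | 1 => A
  | _ => Nat.sub (Nat.sub 31 R) A

def X9 (R A k : ℕ) : ℕ := X (sel R A (Nat.div k 3)) (sel R A (Nat.mod k 3))

def subs (R : ℕ) : List ℕ := (List.range 32).filter fun A => Nat.beq (Nat.land R A) 0

def cand2 (R : ℕ) : List (Unit × ℕ) := (subs R).map fun A => ((), encF 9 (X9 R A))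

def capf (R k : ℕ) : ℕ := (subs R).foldr (fun A y => cond (Nat.ble (X9 R A k) y) y (X9 R A k)) 0

def mask2 : ℕ := 11194099550634979459280674270192118716727424
def bias2 : ℕ := 10407014425980957466050001860569235369457527

def stage2 (R0 R1 R2 R3 R4 : ℕ) : Bool :=
  engine mask2 (256 ^ 9) bias2 (cand2 R0) (cand2 R1) (cand2 R2) (cand2 R3) (cand2 R4)
    (encF 9 (capf R1)) (encF 9 (capf R2)) (encF 9 (capf R3)) (encF 9 (capf R4))
    fun _ _ _ _ _ => false

/-! ### First stage: the positions of one letter -/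

def X4 (R : ℕ) : ℕ → ℕ
  | 0 => X R R
  | 1 => X R (31 - R)
  | 2 => X (31 - R) R
  | _ => X (31 - R) (31 - R)

def need4 : ℕ → ℕ
  | 0 => 9
  | 1 => 18
  | 2 => 18
  | _ => 36

def cap4 : ℕ → ℕ
  | 0 => 10
  | 1 => 6
  | 2 => 6
  | _ => 10

def cap4z : ℕ → ℕ
  | 0 => 0
  | 1 => 0
  | 2 => 0
  | _ => 10

def tab : List (ℕ × ℕ) :=
  [
   (0, 167772160), (1, 100664320), (2, 100729600), (3, 50333185), (4, 100794880), (5,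
   50398465), (6, 50463745), (7, 16778755), (8, 100860160), (9, 50463745), (10, 50529025),
   (11, 16844035), (12, 50594305), (13, 16909315), (14, 16974595), (15, 1030), (16,
   100925440), (17, 50529025), (18, 50594305), (19, 16909315), (20, 50659585), (21,
   16974595), (22, 17039875), (23, 66310), (24, 50724865), (25, 17039875), (26, 17105155),
   (27, 131590), (28, 17170435), (29, 196870), (30, 262150), (31, 10)]

def tabz : List (ℕ × ℕ) := [(0, 167772160)]

def pc (p : Bool) (R : ℕ) : ℕ := cond p R (Nat.sub 31 R)

def cnt (p q p' q' : Bool) (R S : ℕ) : ℕ :=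
  X (Nat.land (pc p R) (pc p' S)) (Nat.land (pc q R) (pc q' S))

def wt (p : Bool) : ℕ := cond p 1 2

def chk (p q p' q' : Bool) (R0 R1 R2 R3 R4 : ℕ) : Bool :=
  Nat.ble (wt p * wt q * wt p' * wt q')
    (Nat.add (cnt p q p' q' R0 R1) (Nat.add (cnt p q p' q' R0 R2) (Nat.add (cnt p q p' q' R0 R3)
    (Nat.add (cnt p q p' q' R0 R4) (Nat.add (cnt p q p' q' R1 R2) (Nat.add (cnt p q p' q' R1 R3)
    (Nat.add (cnt p q p' q' R1 R4) (Nat.add (cnt p q p' q' R2 R3) (Nat.add (cnt p q p' q' R2 R4)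
    (cnt p q p' q' R3 R4))))))))))

def allchk (R0 R1 R2 R3 R4 : ℕ) : Bool :=
  chk false false false false R0 R1 R2 R3 R4 &&
   chk false true true false R0 R1 R2 R3 R4 &&
   chk false true false true R0 R1 R2 R3 R4 &&
   chk false true true true R0 R1 R2 R3 R4 &&
   chk true true true false R0 R1 R2 R3 R4 &&
   chk true false false true R0 R1 R2 R3 R4 &&
   chk true false true false R0 R1 R2 R3 R4 &&
   chk true false true true R0 R1 R2 R3 R4 &&
   chk true true false true R0 R1 R2 R3 R4 &&
   chk false false false true R0 R1 R2 R3 R4 &&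
   chk false true false false R0 R1 R2 R3 R4 &&
   chk false false true false R0 R1 R2 R3 R4 &&
   chk true false false false R0 R1 R2 R3 R4 &&
   chk true true true true R0 R1 R2 R3 R4 &&
   chk false false true true R0 R1 R2 R3 R4 &&
   chk true true false false R0 R1 R2 R3 R4

def leaf1 (R0 R1 R2 R3 R4 : ℕ) : Bool :=
  or (not (allchk R0 R1 R2 R3 R4)) (stage2 R0 R1 R2 R3 R4)

def ltab (z r : ℕ) : List (ℕ × ℕ) := cond (Nat.beq z r) tabz tab

def lcap (z r : ℕ) : ℕ := cond (Nat.beq z r) 167772160 168166922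

def mask1 : ℕ := 9259542123273814144
def bias1 : ℕ := 6660382357858446967

def stage1 (z : ℕ) : Bool :=
  engine mask1 (256 ^ 4) bias1 (ltab z 0) (ltab z 1) (ltab z 2) (ltab z 3) (ltab z 4)
    (lcap z 1) (lcap z 2) (lcap z 3) (lcap z 4) leaf1

theorem stage1_0 : stage1 0 = true := by decide +kernel
theorem stage1_1 : stage1 1 = true := by decide +kernel
theorem stage1_2 : stage1 2 = true := by decide +kernel

/-! ### Facts about the tables -/

def bits (p : Fin 5 → Bool) : ℕ :=
  (p 0).toNat + 2 * (p 1).toNat + 4 * (p 2).toNat + 8 * (p 3).toNat + 16 * (p 4).toNat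

theorem bits_lt (p : Fin 5 → Bool) : bits p < 32 := by
  unfold bits
  have := Bool.toNat_le (p 0); have := Bool.toNat_le (p 1); have := Bool.toNat_le (p 2)
  have := Bool.toNat_le (p 3); have := Bool.toNat_le (p 4)
  omega

def D : Finset (Fin 5 × Fin 5) := Finset.univ.filter fun e => e.1 < e.2

theorem sum_D (g : Fin 5 → Fin 5 → ℕ) : ∑ e ∈ D, g e.1 e.2 =
    g 0 1 + (g 0 2 + (g 0 3 + (g 0 4 + (g 1 2 + (g 1 3 + (g 1 4 + (g 2 3 + (g 2 4 + g 3 4)))))))) := by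
  have : D = {(0, 1), (0, 2), (0, 3), (0, 4), (1, 2), (1, 3), (1, 4), (2, 3), (2, 4), (3, 4)} := by
    decide +kernel
  rw [this]
  repeat rw [Finset.sum_insert (by decide)]
  rw [Finset.sum_singleton]

theorem X_bits_aux : ∀ a b c d e a' b' c' d' e' : Bool,
    X (a.toNat + 2 * b.toNat + 4 * c.toNat + 8 * d.toNat + 16 * e.toNat)
      (a'.toNat + 2 * b'.toNat + 4 * c'.toNat + 8 * d'.toNat + 16 * e'.toNat) =
    (a && b').toNat + ((a && c').toNat + ((a && d').toNat + ((a && e').toNat +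
    ((b && c').toNat + ((b && d').toNat + ((b && e').toNat + ((c && d').toNat +
    ((c && e').toNat + (d && e').toNat)))))))) := by decide +kernel

theorem X_bits (p q : Fin 5 → Bool) :
    X (bits p) (bits q) = ∑ e ∈ D, (p e.1 && q e.2).toNat := by
  rw [sum_D (fun i j => (p i && q j).toNat)]
  exact X_bits_aux ..

theorem land_bits_aux : ∀ a b c d e a' b' c' d' e' : Bool,
    Nat.land (a.toNat + 2 * b.toNat + 4 * c.toNat + 8 * d.toNat + 16 * e.toNat)
      (a'.toNat + 2 * b'.toNat + 4 * c'.toNat + 8 * d'.toNat + 16 * e'.toNat) =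
    (a && a').toNat + 2 * (b && b').toNat + 4 * (c && c').toNat + 8 * (d && d').toNat
      + 16 * (e && e').toNat := by decide +kernel

theorem land_bits (p q : Fin 5 → Bool) :
    Nat.land (bits p) (bits q) = bits (fun i => p i && q i) := land_bits_aux ..

theorem not_bits (p : Fin 5 → Bool) : 31 - bits p = bits (fun i => !(p i)) := by
  have (b : Bool) : (!b).toNat = 1 - b.toNat := by cases b <;> rfl
  simp only [bits, this]
  have := Bool.toNat_le (p 0); have := Bool.toNat_le (p 1); have := Bool.toNat_le (p 2)
  have := Bool.toNat_le (p 3); have := Bool.toNat_le (p 4)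
  omega

theorem pc_bits (c : Bool) (p : Fin 5 → Bool) : pc c (bits p) = bits (fun i => p i == c) := by
  cases c
  · exact (not_bits p).trans (by simp)
  · simp [pc]

theorem tab_mem : ∀ R < 32, (R, encF 4 (X4 R)) ∈ tab := by decide +kernel
theorem tabz_mem : (0, encF 4 (X4 0)) ∈ tabz := by decide +kernel

theorem ltab_mem (z r R : ℕ) (hR : R < 32) (hz : z = r → R = 0) :
    (R, encF 4 (X4 R)) ∈ ltab z r := by
  unfold ltab
  by_cases h : z = r
  · rw [Nat.beq_eq.mpr h, hz h]; exact tabz_mem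
  · have : Nat.beq z r = false := by
      rw [← Bool.not_eq_true, Nat.beq_eq]; exact h
    rw [this]; exact tab_mem R hR

def capz (z r : ℕ) : ℕ → ℕ := cond (Nat.beq z r) cap4z cap4

theorem lcap_eq (z r : ℕ) : lcap z r = encF 4 (capz z r) := by
  unfold lcap capz
  cases Nat.beq z r <;> decide +kernel

theorem cap4_ok : ∀ R < 32, ∀ k < 4, X4 R k ≤ cap4 k ∧ cap4 k ≤ 10 := by decide +kernel
theorem cap4z_ok : ∀ k < 4, X4 0 k ≤ cap4z k ∧ cap4z k ≤ 10 := by decide +kernel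

theorem capz_ok (z r R : ℕ) (hR : R < 32) (hz : z = r → R = 0) :
    ∀ k < 4, X4 R k ≤ capz z r k ∧ capz z r k ≤ 10 := by
  unfold capz
  by_cases h : z = r
  · rw [Nat.beq_eq.mpr h, hz h]; exact cap4z_ok
  · have : Nat.beq z r = false := by
      rw [← Bool.not_eq_true, Nat.beq_eq]; exact h
    rw [this]; exact cap4_ok R hR

theorem capf_ok : ∀ R < 32, ∀ A ∈ subs R, ∀ k < 9, X9 R A k ≤ capf R k ∧ capf R k ≤ 10 := by
  decide +kernel

theorem cand2_mem (R A : ℕ) (h : A ∈ subs R) : ((), encF 9 (X9 R A)) ∈ cand2 R :=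
  List.mem_map.2 ⟨A, h, rfl⟩

/-! ### Counting -/

def Cov (M : Fin 5 → Fin 5 → Fin 3) : Prop :=
  ∀ a b c d : Fin 3, ∃ r s i j : Fin 5, r < s ∧ i < j ∧
    M r i = a ∧ M r j = b ∧ M s i = c ∧ M s j = d

theorem cov_count {M : Fin 5 → Fin 5 → Fin 3} (h : Cov M)
    (Q : Fin 3 × Fin 3 × Fin 3 × Fin 3 → Bool) :
    (Finset.univ.filter fun t => Q t = true).card ≤
      ∑ d ∈ D, ∑ e ∈ D, (Q (M d.1 e.1, M d.1 e.2, M d.2 e.1, M d.2 e.2)).toNat := by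
  have key : ((D ×ˢ D).filter fun x =>
      Q (M x.1.1 x.2.1, M x.1.1 x.2.2, M x.1.2 x.2.1, M x.1.2 x.2.2) = true).card =
      ∑ d ∈ D, ∑ e ∈ D, (Q (M d.1 e.1, M d.1 e.2, M d.2 e.1, M d.2 e.2)).toNat := by
    rw [Finset.card_filter, Finset.sum_product]
    refine Finset.sum_congr rfl fun d _ => Finset.sum_congr rfl fun e _ => ?_
    cases Q (M d.1 e.1, M d.1 e.2, M d.2 e.1, M d.2 e.2) <;> rfl
  rw [← key]
  apply Finset.card_le_card_of_surjOn
    (fun x => (M x.1.1 x.2.1, M x.1.1 x.2.2, M x.1.2 x.2.1, M x.1.2 x.2.2))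
  rintro ⟨a, b, c, d⟩ ht
  obtain ⟨r, s, i, j, hrs, hij, rfl, rfl, rfl, rfl⟩ := h a b c d
  refine ⟨((r, s), (i, j)), ?_, rfl⟩
  simp only [Finset.coe_filter, Set.mem_ofPred_eq, Finset.mem_univ, true_and] at ht
  simp [D, hrs, hij, ht]

theorem count_top {M : Fin 5 → Fin 5 → Fin 3} (h : Cov M) (f g : Fin 3 → Bool) :
    (Finset.univ.filter fun t : Fin 3 × Fin 3 × Fin 3 × Fin 3 => (f t.1 && g t.2.1) = true).card ≤
      4 * X (bits fun i => f (M 0 i)) (bits fun i => g (M 0 i))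
      + 3 * X (bits fun i => f (M 1 i)) (bits fun i => g (M 1 i))
      + 2 * X (bits fun i => f (M 2 i)) (bits fun i => g (M 2 i))
      + X (bits fun i => f (M 3 i)) (bits fun i => g (M 3 i)) := by
  refine (cov_count h fun t => f t.1 && g t.2.1).trans (le_of_eq ?_)
  simp only [X_bits]
  rw [sum_D (fun r _ => ∑ e ∈ D, (f (M r e.1) && g (M r e.2)).toNat)]
  ring

theorem count_bot {M : Fin 5 → Fin 5 → Fin 3} (h : Cov M) (f g : Fin 3 → Bool) :
    (Finset.univ.filter
      fun t : Fin 3 × Fin 3 × Fin 3 × Fin 3 => (f t.2.2.1 && g t.2.2.2) = true).card ≤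
      X (bits fun i => f (M 1 i)) (bits fun i => g (M 1 i))
      + 2 * X (bits fun i => f (M 2 i)) (bits fun i => g (M 2 i))
      + 3 * X (bits fun i => f (M 3 i)) (bits fun i => g (M 3 i))
      + 4 * X (bits fun i => f (M 4 i)) (bits fun i => g (M 4 i)) := by
  refine (cov_count h fun t => f t.2.2.1 && g t.2.2.2).trans (le_of_eq ?_)
  simp only [X_bits]
  rw [sum_D (fun _ r => ∑ e ∈ D, (f (M r e.1) && g (M r e.2)).toNat)]
  ring

def isv (x : Fin 3) : Fin 3 → Bool := fun a => decide (a = x)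

/-- Bit mask of the positions of the letter `x` in row `r`. -/
def row (M : Fin 5 → Fin 5 → Fin 3) (x : Fin 3) (r : Fin 5) : ℕ := bits fun i => isv x (M r i)

theorem row_lt (M : Fin 5 → Fin 5 → Fin 3) (x : Fin 3) (r : Fin 5) : row M x r < 32 := bits_lt _

theorem chk_true {M : Fin 5 → Fin 5 → Fin 3} (h : Cov M) (p q p' q' : Bool) :
    chk p q p' q' (row M 0 0) (row M 0 1) (row M 0 2) (row M 0 3) (row M 0 4) = true := by
  unfold chk
  rw [Nat.ble_eq]
  have hc := cov_count h fun t => ((isv 0 t.1 == p) && (isv 0 t.2.2.1 == p')) &&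
    ((isv 0 t.2.1 == q) && (isv 0 t.2.2.2 == q'))
  have e : (Finset.univ.filter fun t : Fin 3 × Fin 3 × Fin 3 × Fin 3 =>
      (((isv 0 t.1 == p) && (isv 0 t.2.2.1 == p')) &&
      ((isv 0 t.2.1 == q) && (isv 0 t.2.2.2 == q'))) = true).card
      = wt p * wt q * wt p' * wt q' := by
    clear hc
    revert p q p' q'
    decide +kernel
  rw [e] at hc
  refine hc.trans (le_of_eq ?_)
  have hr (r s : Fin 5) : cnt p q p' q' (row M 0 r) (row M 0 s) =
      ∑ e ∈ D, (((isv 0 (M r e.1) == p) && (isv 0 (M s e.1) == p')) &&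
        ((isv 0 (M r e.2) == q) && (isv 0 (M s e.2) == q'))).toNat := by
    unfold cnt row
    simp only [pc_bits, land_bits, X_bits]
  simp only [hr]
  exact sum_D (fun r s => ∑ e ∈ D, (((isv 0 (M r e.1) == p) && (isv 0 (M s e.1) == p')) &&
        ((isv 0 (M r e.2) == q) && (isv 0 (M s e.2) == q'))).toNat)

theorem row_not (M : Fin 5 → Fin 5 → Fin 3) (x : Fin 3) (r : Fin 5) :
    31 - row M x r = bits fun i => !(isv x (M r i)) := not_bits _

theorem row_subs (M : Fin 5 → Fin 5 → Fin 3) (r : Fin 5) : row M 1 r ∈ subs (row M 0 r) := by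
  unfold subs
  rw [List.mem_filter, List.mem_range, Nat.beq_eq]
  refine ⟨row_lt M 1 r, ?_⟩
  unfold row
  rw [land_bits]
  have (a : Fin 3) : (isv 0 a && isv 1 a) = false := by revert a; decide
  simp only [this]
  rfl

theorem row_two (M : Fin 5 → Fin 5 → Fin 3) (r : Fin 5) :
    31 - row M 0 r - row M 1 r = row M 2 r := by
  have hh (a : Fin 3) : (isv 0 a).toNat + (isv 1 a).toNat + (isv 2 a).toNat = 1 := by
    revert a; decide
  have := hh (M r 0); have := hh (M r 1); have := hh (M r 2)
  have := hh (M r 3); have := hh (M r 4)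
  simp only [row, bits]
  omega

theorem X9_row (M : Fin 5 → Fin 5 → Fin 3) (r : Fin 5) (k : ℕ) (hk : k < 9) :
    X9 (row M 0 r) (row M 1 r) k =
      X (row M ⟨k / 3, by omega⟩ r) (row M ⟨k % 3, by omega⟩ r) := by
  have h2 := row_two M r
  interval_cases k <;> simp only [X9, sel] <;> first | rfl | simp [h2]

theorem stage2_false {M : Fin 5 → Fin 5 → Fin 3} (h : Cov M) :
    stage2 (row M 0 0) (row M 0 1) (row M 0 2) (row M 0 3) (row M 0 4) = false := by
  rw [← Bool.not_eq_true]
  intro hs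
  have hcard1 : ∀ x y : Fin 3, (Finset.univ.filter fun t : Fin 3 × Fin 3 × Fin 3 × Fin 3 =>
      (isv x t.1 && isv y t.2.1) = true).card = 9 := by decide +kernel
  have hcard2 : ∀ x y : Fin 3, (Finset.univ.filter fun t : Fin 3 × Fin 3 × Fin 3 × Fin 3 =>
      (isv x t.2.2.1 && isv y t.2.2.2) = true).card = 9 := by decide +kernel
  have hc (r : Fin 5) := capf_ok (row M 0 r) (row_lt M 0 r) (row M 1 r) (row_subs M r)
  have := engine_sound 9 (fun _ => 119) (fun _ => 9)
    (X9 (row M 0 0) (row M 1 0)) (X9 (row M 0 1) (row M 1 1)) (X9 (row M 0 2) (row M 1 2))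
    (X9 (row M 0 3) (row M 1 3)) (X9 (row M 0 4) (row M 1 4))
    (capf (row M 0 1)) (capf (row M 0 2)) (capf (row M 0 3)) (capf (row M 0 4))
    (fun _ _ => rfl)
    (fun k hk => by
      have := count_top h (isv ⟨k / 3, by omega⟩) (isv ⟨k % 3, by omega⟩)
      rw [hcard1] at this
      rw [X9_row M 0 k hk, X9_row M 1 k hk, X9_row M 2 k hk, X9_row M 3 k hk]
      exact this)
    (fun k hk => by
      have := count_bot h (isv ⟨k / 3, by omega⟩) (isv ⟨k % 3, by omega⟩)
      rw [hcard2] at this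
      rw [X9_row M 1 k hk, X9_row M 2 k hk, X9_row M 3 k hk, X9_row M 4 k hk]
      exact this)
    (fun k hk => (hc 0 k hk).1.trans (hc 0 k hk).2) (hc 1) (hc 2) (hc 3) (hc 4)
    _ _ _ _ _ _ _ _ _ _ _ _ _ () () () () () (by decide +kernel) rfl (by decide +kernel)
    rfl rfl rfl rfl
    (cand2_mem _ _ (row_subs M 0)) (cand2_mem _ _ (row_subs M 1)) (cand2_mem _ _ (row_subs M 2))
    (cand2_mem _ _ (row_subs M 3)) (cand2_mem _ _ (row_subs M 4)) hs
  exact absurd this (by decide)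

def f4 (k : ℕ) : Fin 3 → Bool := fun a => isv 0 a == decide (k < 2)
def g4 (k : ℕ) : Fin 3 → Bool := fun a => isv 0 a == decide (k % 2 = 0)

theorem X4_row (M : Fin 5 → Fin 5 → Fin 3) (r : Fin 5) (k : ℕ) (hk : k < 4) :
    X4 (row M 0 r) k = X (bits fun i => f4 k (M r i)) (bits fun i => g4 k (M r i)) := by
  interval_cases k <;> simp only [X4, row_not] <;> simp [f4, g4, row]

theorem stage1_false {M : Fin 5 → Fin 5 → Fin 3} (h : Cov M) (z : Fin 5)
    (hz : ∀ j, M z j ≠ 0) : stage1 z = false := by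
  rw [← Bool.not_eq_true]
  intro hs
  have hz0 : row M 0 z = 0 := by
    have (i : Fin 5) : isv 0 (M z i) = false := by simp [isv, hz i]
    unfold row
    simp only [this]
    rfl
  have hzr (r : Fin 5) : (z : ℕ) = (r : ℕ) → row M 0 r = 0 := by
    intro e
    rw [← Fin.ext e]; exact hz0
  have hcard1 : ∀ k < 4, (Finset.univ.filter fun t : Fin 3 × Fin 3 × Fin 3 × Fin 3 =>
      (f4 k t.1 && g4 k t.2.1) = true).card = need4 k := by decide +kernel
  have hcard2 : ∀ k < 4, (Finset.univ.filter fun t : Fin 3 × Fin 3 × Fin 3 × Fin 3 =>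
      (f4 k t.2.2.1 && g4 k t.2.2.2) = true).card = need4 k := by decide +kernel
  have hc (r : Fin 5) := capz_ok z r (row M 0 r) (row_lt M 0 r) (hzr r)
  have hm (r : Fin 5) := ltab_mem z r (row M 0 r) (row_lt M 0 r) (hzr r)
  have := engine_sound 4 (fun k => 128 - need4 k) need4
    (X4 (row M 0 0)) (X4 (row M 0 1)) (X4 (row M 0 2)) (X4 (row M 0 3)) (X4 (row M 0 4))
    (capz z 1) (capz z 2) (capz z 3) (capz z 4)
    (by decide)
    (fun k hk => by
      have := count_top h (f4 k) (g4 k)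
      rw [hcard1 k hk] at this
      rw [X4_row M 0 k hk, X4_row M 1 k hk, X4_row M 2 k hk, X4_row M 3 k hk]
      exact this)
    (fun k hk => by
      have := count_bot h (f4 k) (g4 k)
      rw [hcard2 k hk] at this
      rw [X4_row M 1 k hk, X4_row M 2 k hk, X4_row M 3 k hk, X4_row M 4 k hk]
      exact this)
    (fun k hk => (hc 0 k hk).1.trans (hc 0 k hk).2) (hc 1) (hc 2) (hc 3) (hc 4)
    _ _ _ _ _ _ _ _ _ _ _ _ _ _ _ _ _ _ (by decide +kernel) rfl (by decide +kernel)
    (lcap_eq z 1) (lcap_eq z 2) (lcap_eq z 3) (lcap_eq z 4)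
    (hm 0) (hm 1) (hm 2) (hm 3) (hm 4) hs
  unfold leaf1 at this
  rw [stage2_false h] at this
  have ha : allchk (row M 0 0) (row M 0 1) (row M 0 2) (row M 0 3) (row M 0 4) = true := by
    unfold allchk
    simp only [chk_true h, Bool.and_self]
  rw [ha] at this
  exact absurd this (by decide)

theorem cov_rev {M : Fin 5 → Fin 5 → Fin 3} (h : Cov M) : Cov fun i j => M i.rev j := by
  intro a b c d
  obtain ⟨r, s, i, j, hrs, hij, h1, h2, h3, h4⟩ := h c d a b
  refine ⟨s.rev, r.rev, i, j, Fin.rev_lt_rev.2 hrs, hij, ?_⟩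
  simp [h1, h2, h3, h4]

theorem cov_main {M : Fin 5 → Fin 5 → Fin 3} (h : Cov M) (z : Fin 5) : ∃ j, M z j = 0 := by
  by_contra hcon
  have hz : ∀ j, M z j ≠ 0 := fun j hj => hcon ⟨j, hj⟩
  have hz' : ∀ j, (fun i j => M i.rev j) z.rev j ≠ 0 := by simpa using hz
  have e1 := stage1_false h z hz
  have e2 := stage1_false (cov_rev h) z.rev hz'
  have key : ∀ n : ℕ, n < 3 → stage1 n = true := by
    intro n hn
    interval_cases n
    exacts [stage1_0, stage1_1, stage1_2]
  by_cases hlt : (z : ℕ) < 3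
  · rw [key z hlt] at e1
    exact Bool.noConfusion e1
  · rw [key z.rev (by rw [Fin.val_rev]; omega)] at e2
    exact Bool.noConfusion e2

end Omni

theorem rows_contain_all_letters (M : Fin 5 → Fin 5 → Fin 3)
    (h : IsOmnimosaic 3 2 M) :
    ∀ i : Fin 5, ∀ v : Fin 3, ∃ j : Fin 5, M i j = v := by
  intro z v
  have hc : Omni.Cov fun i j => M i j - v := by
    intro a b c d
    obtain ⟨ρ, σ, hρ, hσ, hT⟩ := h ![![a + v, b + v], ![c + v, d + v]]
    refine ⟨ρ 0, ρ 1, σ 0, σ 1, hρ (by decide), hσ (by decide), ?_, ?_, ?_, ?_⟩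
    · simp [← hT 0 0]
    · simp [← hT 0 1]
    · simp [← hT 1 0]
    · simp [← hT 1 1]
  obtain ⟨j, hj⟩ := Omni.cov_main hc z
  exact ⟨j, sub_eq_zero.1 hj⟩
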